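/- arXiv:1507.05080 — 3 statements merged into one kernel-verified Lean document; each statement's English description precedes it below -/
import Mathlib

section
/- Fix integers n > 3k ≥ 3 and a nonzero integer θ with x^n − θ irreducible over ℚ. For a vector v ∈ ℤ^n define T(v) by T(v)_j = v_{j+1} for j < n and T(v)_n = θ·v_1. Given b ∈ ℤ^n \ {0}, let L be a linear subspace of ℝ^n such that for every x ∈ L, the 2k vectors T^0(x),...,T^{k−1}(x), T^0(b),...,T^{k−1}(b) span a subspace of dimension strictly less than 2k (i.e. all 2k×2k minors of the corresponding 2k×n matrix vanish). Then dim L ≤ k. -/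
/-- The shift-with-`θ` linear map on `ℝ^n`: `(T v)_j = v_{j+1}` for `j < n` and `(T v)_n = θ v_1`. -/
noncomputable def Tmap (n : ℕ) (θ : ℤ) (v : Fin n → ℝ) : Fin n → ℝ :=
  fun j => if h : (j : ℕ) + 1 < n then v ⟨(j : ℕ) + 1, h⟩ else (θ : ℝ) * v ⟨0, j.pos⟩

/-- The shift-with-`θ` map over a general field, as a linear map. -/
def shiftLin (F : Type*) [Field F] (n : ℕ) (θ : F) : (Fin n → F) →ₗ[F] (Fin n → F) where
  toFun v := fun j => if h : (j : ℕ) + 1 < n then v ⟨(j : ℕ) + 1, h⟩ else θ * v ⟨0, j.pos⟩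
  map_add' u v := by
    ext j
    by_cases h : (j : ℕ) + 1 < n <;> simp [h, mul_add]
  map_smul' c v := by
    ext j
    by_cases h : (j : ℕ) + 1 < n <;> simp [h, mul_left_comm]

theorem shiftLin_pow_apply {F : Type*} [Field F] {n : ℕ} (θ : F) (v : Fin n → F) (i : ℕ)
    (hi : i ≤ n) (j : Fin n) :
    (shiftLin F n θ ^ i) v j =
      if h : (j : ℕ) + i < n then v ⟨j + i, h⟩ else θ * v ⟨j + i - n, by omega⟩ := by
  induction i generalizing j with
  | zero => simp
  | succ i ih =>
    rw [pow_succ', Module.End.mul_apply]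
    change (if h : (j : ℕ) + 1 < n then _ else _) = _
    by_cases h : (j : ℕ) + 1 < n
    · rw [dif_pos h, ih (by omega)]
      simp only [show (j : ℕ) + 1 + i = j + (i + 1) by omega]
    · rw [dif_neg h, ih (by omega), dif_pos (by simp; omega), dif_neg (by omega)]
      congr 3
      simp only [zero_add]
      omega

open Polynomial in
theorem aeval_shiftLin_eq_zero {F : Type*} [Field F] (n : ℕ) (θ : F) :
    aeval (shiftLin F n θ) (X ^ n - C θ) = 0 := by
  ext1 v
  ext j
  simp [Algebra.algebraMap_eq_smul_one, shiftLin_pow_apply θ _ n le_rfl]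

open Polynomial in
theorem natDegree_lt_of_degree_lt {F : Type*} [Field F] {n : ℕ} {p : F[X]} (hn : 0 < n)
    (h : p.degree < (n : WithBot ℕ)) : p.natDegree < n := by
  by_cases hp : p = 0
  · simpa [hp] using hn
  · exact (natDegree_lt_iff_degree_lt hp).2 h

open Polynomial in
theorem aeval_apply_eq_sum {F M : Type*} [Field F] [AddCommGroup M] [Module F M]
    (T : M →ₗ[F] M) (v : M) {n : ℕ} (g : Fin n → F) :
    aeval T (∑ i : Fin n, C (g i) * X ^ (i : ℕ)) v = ∑ i : Fin n, g i • (T ^ (i : ℕ)) v := by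
  simp [map_sum, LinearMap.sum_apply, Algebra.algebraMap_eq_smul_one]

open Polynomial in
theorem coeff_sum_fin {F : Type*} [Field F] {n : ℕ} (g : Fin n → F) (m : ℕ) :
    (∑ i : Fin n, C (g i) * X ^ (i : ℕ)).coeff m = if h : m < n then g ⟨m, h⟩ else 0 := by
  rw [finsetSum_coeff]
  simp only [coeff_C_mul, coeff_X_pow, mul_ite, mul_one, mul_zero]
  split_ifs with h
  · rw [Finset.sum_eq_single ⟨m, h⟩]
    · simp
    · intro b _ hb
      rw [if_neg]
      rintro rfl
      exact hb rfl
    · simp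
  · refine Finset.sum_eq_zero fun i _ => if_neg ?_
    have := i.2
    omega

open Polynomial in
theorem degree_sum_C_mul_X_pow_lt {F : Type*} [Field F] {n : ℕ} (g : Fin n → F) :
    (∑ i : Fin n, C (g i) * X ^ (i : ℕ)).degree < (n : WithBot ℕ) := by
  rw [degree_lt_iff_coeff_zero]
  intro m hm
  rw [coeff_sum_fin, dif_neg (by omega)]

open Polynomial in
theorem linearIndependent_shiftLin_pow {F : Type*} [Field F] {n : ℕ} (θ : F)
    (hirr : Irreducible ((X : F[X]) ^ n - C θ)) (hn : 0 < n) {b : Fin n → F} (hb : b ≠ 0) :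
    LinearIndependent F (fun i : Fin n => (shiftLin F n θ ^ (i : ℕ)) b) := by
  rw [Fintype.linearIndependent_iff]
  intro g hg
  by_contra! hne
  obtain ⟨i, hi⟩ := hne
  set f : F[X] := ∑ i : Fin n, C (g i) * X ^ (i : ℕ) with hf
  have hf0 : f ≠ 0 := by
    intro h
    have := coeff_sum_fin g i
    rw [← hf, h, dif_pos i.2] at this
    exact hi (by simpa using this.symm)
  have hnd : ¬ (X ^ n - C θ) ∣ f := by
    intro h
    have h1 := degree_le_of_dvd h hf0
    rw [degree_X_pow_sub_C hn] at h1
    exact absurd (degree_sum_C_mul_X_pow_lt g) (not_lt.mpr h1)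
  obtain ⟨u, w, huw⟩ := (hirr.coprime_iff_not_dvd).2 hnd
  apply hb
  have h2 : aeval (shiftLin F n θ) (u * (X ^ n - C θ) + w * f) b = b := by
    rw [huw]; simp
  rw [← h2, map_add, map_mul, map_mul, aeval_shiftLin_eq_zero, LinearMap.add_apply,
    Module.End.mul_apply, Module.End.mul_apply, hf, aeval_apply_eq_sum, hg]
  simp

theorem shiftLin_pow_cast {n : ℕ} (θ : ℤ) (b : Fin n → ℤ) (i : ℕ) (hi : i ≤ n) (j : Fin n) :
    (shiftLin ℝ n (θ : ℝ) ^ i) (fun t => (b t : ℝ)) j =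
      (((shiftLin ℚ n (θ : ℚ) ^ i) (fun t => (b t : ℚ)) j : ℚ) : ℝ) := by
  rw [shiftLin_pow_apply _ _ _ hi, shiftLin_pow_apply _ _ _ hi]
  split_ifs <;> push_cast <;> rfl

open Polynomial in
theorem linearIndependent_shiftLin_pow_real {n : ℕ} (θ : ℤ)
    (hirr : Irreducible ((X : ℚ[X]) ^ n - C (θ : ℚ))) (hn : 0 < n) {b : Fin n → ℤ} (hb : b ≠ 0) :
    LinearIndependent ℝ
      (fun i : Fin n => (shiftLin ℝ n (θ : ℝ) ^ (i : ℕ)) (fun t => (b t : ℝ))) := by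
  have hbQ : (fun t => (b t : ℚ)) ≠ 0 := by
    intro h
    apply hb
    ext t
    simpa using congrFun h t
  have hQ := linearIndependent_shiftLin_pow (θ : ℚ) hirr hn hbQ
  set A : Matrix (Fin n) (Fin n) ℚ :=
    Matrix.of fun i : Fin n => (shiftLin ℚ n (θ : ℚ) ^ (i : ℕ)) (fun t => (b t : ℚ)) with hA
  have hdet : IsUnit A := Matrix.linearIndependent_rows_iff_isUnit.1 hQ
  have hR : IsUnit (A.map (algebraMap ℚ ℝ)) := hdet.map (algebraMap ℚ ℝ).mapMatrix
  have := Matrix.linearIndependent_rows_iff_isUnit.2 hR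
  have hrow : (fun i : Fin n => (shiftLin ℝ n (θ : ℝ) ^ (i : ℕ)) (fun t => (b t : ℝ))) =
      (A.map (algebraMap ℚ ℝ)).row := by
    ext i j
    simp [hA, shiftLin_pow_cast θ b i i.2.le j, Matrix.row]
  rw [hrow]
  exact this

theorem exists_ne_zero_forall_mem_eq_zero {V : Type*} [AddCommGroup V] [Module ℝ V]
    (φ : ℕ → V →ₗ[ℝ] ℝ) (S : Finset ℕ) (hS : S.card < Module.finrank ℝ V) :
    ∃ v : V, v ≠ 0 ∧ ∀ i ∈ S, φ i v = 0 := by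
  have : FiniteDimensional ℝ V := Module.finite_of_finrank_pos (by omega)
  have h := LinearMap.ker_ne_bot_of_finrank_lt (f := LinearMap.pi (fun i : S => φ i)) (by simpa)
  obtain ⟨v, hv, hv0⟩ := Submodule.exists_mem_ne_zero_of_ne_bot h
  refine ⟨v, hv0, fun i hi => ?_⟩
  exact congrFun (LinearMap.mem_ker.1 hv) ⟨i, hi⟩

/-- A linear space of sequences of length `N ≥ 3k`, each satisfying a nontrivial linear relation
on its windows of length `k`, has dimension less than `k`. -/
theorem finrank_lt_of_forall_window_relation {V : Type*} [AddCommGroup V] [Module ℝ V]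
    (k N : ℕ) (hk : 1 ≤ k) (hN : 3 * k ≤ N) (φ : ℕ → V →ₗ[ℝ] ℝ)
    (hinj : ∀ v, (∀ i < N, φ i v = 0) → v = 0)
    (hdeg : ∀ v, ∃ P : Fin k → ℝ, P ≠ 0 ∧
      ∀ c, c + k ≤ N → ∑ a : Fin k, P a * φ ((a : ℕ) + c) v = 0) :
    Module.finrank ℝ V < k := by
  classical
  by_contra! hV
  have hlead : ∃ q, k - 1 ≤ q ∧ ∃ v, (∀ i < q, φ i v = 0) ∧ φ q v ≠ 0 := by
    obtain ⟨v, hv0, hv⟩ := exists_ne_zero_forall_mem_eq_zero φ (Finset.range (k - 1))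
      (by simp; omega)
    have hne : ∃ i, φ i v ≠ 0 := by
      by_contra! h
      exact hv0 (hinj v fun i _ => h i)
    refine ⟨Nat.find hne, ?_, v, ?_, Nat.find_spec hne⟩
    · by_contra! h
      exact Nat.find_spec hne (hv _ (by simpa using h))
    · intro i hi
      by_contra h
      exact Nat.find_min hne hi h
  set q := Nat.find hlead with hq
  obtain ⟨hq1, f, hf, hfq⟩ := Nat.find_spec hlead
  rw [← hq] at hq1 hf hfq
  have hmin : ∀ v, (∀ i < k - 1, φ i v = 0) → ∀ i < q, φ i v = 0 := by
    intro v hv i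
    induction i using Nat.strong_induction_on with
    | _ i ih =>
      intro hi
      by_contra h
      by_cases hik : i < k - 1
      · exact h (hv i hik)
      · exact Nat.find_min hlead hi ⟨by omega, v, fun j hj => ih j hj (by omega), h⟩
  by_cases hqN : q + k ≤ N
  · obtain ⟨P, hP0, hP⟩ := hdeg f
    let D : Matrix (Fin k) (Fin k) ℝ := Matrix.of fun b a => φ ((b : ℕ) + (q - a)) f
    have hD : D.det = 0 := by
      refine Matrix.exists_vecMul_eq_zero_iff.1 ⟨P, hP0, ?_⟩
      ext a
      exact hP (q - a) (by omega)
    rw [Matrix.det_of_isLowerTriangular] at hD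
    · obtain ⟨a, -, ha⟩ := Finset.prod_eq_zero_iff.1 hD
      apply hfq
      have := a.2
      simpa [D, show (a : ℕ) + (q - a) = q by omega] using ha
    · intro b a hba
      have h : (b : ℕ) < a := hba
      exact hf _ (by omega)
  · have hqlt : q < N := by
      by_contra! h
      apply hfq
      rw [hinj f fun i hi => hf i (by omega), map_zero]
    have hp : ∃ p, p + 1 < k ∧ q + k ≤ N + p + 1 ∧
        ∃ e, (∀ i < p, φ i e = 0) ∧ φ p e ≠ 0 := by
      obtain ⟨v, hv0, hv⟩ := exists_ne_zero_forall_mem_eq_zero φ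
        (Finset.range (q + k - N - 1) ∪ Finset.Ico q N)
        (lt_of_le_of_lt (Finset.card_union_le _ _) (by
          simp only [Finset.card_range, Nat.card_Ico]
          omega))
      have hne : ∃ i, i < k - 1 ∧ φ i v ≠ 0 := by
        by_contra! h
        refine hv0 (hinj v fun i hi => ?_)
        by_cases hiq : i < q
        · exact hmin v h i hiq
        · exact hv i (by simp; omega)
      obtain ⟨h1, h2⟩ := Nat.find_spec hne
      refine ⟨Nat.find hne, by omega, ?_, v, ?_, h2⟩
      · by_contra! h
        exact h2 (hv _ (by simp only [Finset.mem_union, Finset.mem_range]; omega))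
      · intro i hi
        by_contra h
        exact Nat.find_min hne hi ⟨by omega, h⟩
    obtain ⟨p, hpk, hpq, e, he, hep⟩ := hp
    let D : ℝ → Matrix (Fin k) (Fin k) ℝ := fun ε => Matrix.of fun b a =>
      if (a : ℕ) ≤ p then φ ((b : ℕ) + (p - a)) e
      else ε * φ ((b : ℕ) + (q - a)) e + φ ((b : ℕ) + (q - a)) f
    have hcont : Continuous fun ε => (D ε).det := by
      refine Continuous.matrix_det (continuous_matrix fun b a => ?_)
      simp only [D, Matrix.of_apply]
      split_ifs <;> fun_prop
    have hDε : ∀ ε ≠ 0, (D ε).det = 0 := by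
      intro ε hε
      obtain ⟨P, hP0, hP⟩ := hdeg (e + ε⁻¹ • f)
      refine Matrix.exists_vecMul_eq_zero_iff.1 ⟨P, hP0, ?_⟩
      ext a
      simp only [Matrix.vecMul, dotProduct, D, Matrix.of_apply, Pi.zero_apply]
      split_ifs with ha
      · rw [← hP (p - a) (by omega)]
        refine Finset.sum_congr rfl fun b _ => ?_
        rw [map_add, map_smul, hf _ (by omega)]
        simp
      · rw [← mul_zero ε, ← hP (q - a) (by omega), Finset.mul_sum]
        refine Finset.sum_congr rfl fun b _ => ?_
        rw [map_add, map_smul, smul_eq_mul]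
        field_simp
    have hD0 : (D 0).det = 0 := congrFun
      (hcont.ext_on (dense_compl_singleton (0 : ℝ)) continuous_const fun ε hε => hDε ε hε) 0
    rw [Matrix.det_of_isLowerTriangular] at hD0
    · obtain ⟨a, -, ha⟩ := Finset.prod_eq_zero_iff.1 hD0
      have := a.2
      simp only [D, Matrix.of_apply] at ha
      split_ifs at ha with hap
      · rw [show (a : ℕ) + (p - a) = p by omega] at ha
        exact hep ha
      · rw [show (a : ℕ) + (q - a) = q by omega] at ha
        exact hfq (by simpa using ha)
    · intro b a hba
      have h : (b : ℕ) < a := hba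
      simp only [D, Matrix.of_apply]
      split_ifs
      · exact he _ (by omega)
      · rw [hf _ (by omega)]
        simp

open Polynomial in
theorem exists_window_relation {n k : ℕ} (hk : 1 ≤ k) (hnk : 3 * k < n) (θ : ℝ)
    (b : Fin n → ℝ)
    (B : Module.Basis (Fin n) ℝ (Fin n → ℝ))
    (hB : ∀ i : Fin n, B i = (shiftLin ℝ n θ ^ (i : ℕ)) b) (x : Fin n → ℝ)
    (hx : ¬ LinearIndependent ℝ (fun i : Fin (2 * k) =>
      if (i : ℕ) < k then (shiftLin ℝ n θ ^ (i : ℕ)) x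
      else (shiftLin ℝ n θ ^ ((i : ℕ) - k)) b)) :
    ∃ P : Fin k → ℝ, P ≠ 0 ∧ ∀ c, c + k ≤ n - 1 →
      ∑ a : Fin k, P a * (if h : (a : ℕ) + c + 1 < n then B.repr x ⟨a + c + 1, h⟩ else 0) = 0 := by
  set T := shiftLin ℝ n θ with hT
  have hn : 0 < n := by omega
  have hmonic : ((X : ℝ[X]) ^ n - C θ).Monic := monic_X_pow_sub_C θ (by omega)
  have hdvd : ∀ f : ℝ[X], aeval T f b = 0 → (X ^ n - C θ) ∣ f := by
    intro f hf
    rw [← modByMonic_eq_zero_iff_dvd hmonic]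
    set r := f %ₘ (X ^ n - C θ) with hr
    have hrdeg : r.degree < n := by
      rw [← degree_X_pow_sub_C hn θ]
      exact degree_modByMonic_lt _ hmonic
    have hr0 : aeval T r b = 0 := by
      rw [← modByMonic_add_div f (X ^ n - C θ), map_add, map_mul, aeval_shiftLin_eq_zero] at hf
      simpa using hf
    rw [aeval_eq_sum_range' (n := n) ?_] at hr0
    · rw [LinearMap.sum_apply, ← Fin.sum_univ_eq_sum_range
        (fun i => (r.coeff i • T ^ i) b)] at hr0
      have := Fintype.linearIndependent_iff.1 B.linearIndependent (fun i => r.coeff i)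
        (by simpa [hB] using hr0)
      ext m
      by_cases hm : m < n
      · simpa using this ⟨m, hm⟩
      · simpa using (degree_lt_iff_coeff_zero _ _).1 hrdeg m (by omega)
    · exact natDegree_lt_of_degree_lt hn hrdeg
  obtain ⟨g, hg, i₀, hi₀⟩ := Fintype.not_linearIndependent_iff.1 hx
  let gP : Fin k → ℝ := fun i => g ⟨i, by omega⟩
  let gQ : Fin k → ℝ := fun i => g ⟨k + i, by omega⟩
  have hsum : ∑ i : Fin k, gP i • (T ^ (i : ℕ)) x + ∑ i : Fin k, gQ i • (T ^ (i : ℕ)) b = 0 := by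
    rw [← hg, ← (finCongr (two_mul k).symm).sum_comp, Fin.sum_univ_add]
    congr 1
    · refine Finset.sum_congr rfl fun i _ => ?_
      simp [gP]
      rfl
    · refine Finset.sum_congr rfl fun i _ => ?_
      simp [gQ, Fin.natAdd]
  set P : ℝ[X] := ∑ i : Fin k, C (gP i) * X ^ (i : ℕ) with hPdef
  set Q : ℝ[X] := ∑ i : Fin k, C (gQ i) * X ^ (i : ℕ) with hQdef
  set Y : ℝ[X] := ∑ i : Fin n, C (B.repr x i) * X ^ (i : ℕ) with hYdef
  have hY : aeval T Y b = x := by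
    rw [hYdef, aeval_apply_eq_sum]
    simp_rw [← hB]
    exact B.sum_repr x
  have hPQ : (X ^ n - C θ) ∣ P * Y + Q := by
    apply hdvd
    rw [map_add, map_mul, LinearMap.add_apply, Module.End.mul_apply, hY, aeval_apply_eq_sum,
      aeval_apply_eq_sum, hsum]
  have hgP : gP ≠ 0 := by
    intro h0
    have hP0 : P = 0 := by simp [hPdef, h0]
    rw [hP0, zero_mul, zero_add] at hPQ
    have hQ0 : Q = 0 := by
      refine eq_zero_of_dvd_of_degree_lt hPQ ?_
      rw [degree_X_pow_sub_C hn]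
      exact (degree_sum_C_mul_X_pow_lt gQ).trans_le (by exact_mod_cast (by omega : k ≤ n))
    apply hi₀
    by_cases hik : (i₀ : ℕ) < k
    · exact congrFun h0 ⟨i₀, hik⟩
    · have h1 := coeff_sum_fin gQ (i₀ - k)
      rw [← hQdef, hQ0, dif_pos (by omega)] at h1
      simp only [coeff_zero, gQ, show k + ((i₀ : ℕ) - k) = i₀ by omega] at h1
      exact h1.symm
  obtain ⟨R, hR⟩ := hPQ
  have hdegPY : (P * Y + Q).natDegree ≤ n + k - 2 := by
    have h1 : P.natDegree ≤ k - 1 := by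
      have : P.natDegree < _ := natDegree_lt_of_degree_lt hk (degree_sum_C_mul_X_pow_lt gP)
      omega
    have h2 : Q.natDegree ≤ k - 1 := by
      have : Q.natDegree < _ := natDegree_lt_of_degree_lt hk (degree_sum_C_mul_X_pow_lt gQ)
      omega
    have h3 : Y.natDegree ≤ n - 1 := by
      have : Y.natDegree < _ := natDegree_lt_of_degree_lt hn (degree_sum_C_mul_X_pow_lt (B.repr x))
      omega
    refine (natDegree_add_le _ _).trans (max_le (natDegree_mul_le.trans ?_) ?_) <;> omega
  have hRcoeff : ∀ m, k ≤ m → R.coeff m = 0 := by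
    intro m hm
    apply coeff_eq_zero_of_natDegree_lt
    by_cases hR0 : R = 0
    · simp [hR0]; omega
    · rw [hR, hmonic.natDegree_mul' hR0, natDegree_X_pow_sub_C] at hdegPY
      omega
  have hcoeff : ∀ m, k ≤ m → m < n → (P * Y).coeff m = 0 := by
    intro m hkm hmn
    have h1 : (P * Y).coeff m + Q.coeff m = ((X ^ n - C θ) * R).coeff m := by
      rw [← hR, coeff_add]
    rw [sub_mul, coeff_sub, coeff_X_pow_mul', if_neg (by omega), coeff_C_mul, hRcoeff m hkm,
      hQdef, coeff_sum_fin, dif_neg (by omega)] at h1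
    simpa using h1
  refine ⟨fun a => gP a.rev, ?_, fun c hc => ?_⟩
  · intro h0
    apply hgP
    ext a
    simpa using congrFun h0 a.rev
  · refine Eq.trans ?_ (hcoeff (c + k) (by omega) (by omega))
    rw [hPdef, Finset.sum_mul, finsetSum_coeff]
    refine Eq.trans ?_ (Equiv.sum_comp Fin.revPerm
      (fun i : Fin k => (C (gP i) * X ^ (i : ℕ) * Y).coeff (c + k)))
    refine Finset.sum_congr rfl fun a _ => ?_
    rw [mul_assoc, coeff_C_mul, coeff_X_pow_mul', if_pos (by omega), hYdef, coeff_sum_fin]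
    simp only [Fin.revPerm_apply, Fin.val_rev,
      show c + k - (k - ((a : ℕ) + 1)) = a + c + 1 by omega]

theorem Tmap_iterate (n : ℕ) (θ : ℤ) (i : ℕ) (v : Fin n → ℝ) :
    (Tmap n θ)^[i] v = (shiftLin ℝ n (θ : ℝ) ^ i) v := by
  rw [Module.End.pow_apply]
  rfl

/-- **Linear subspaces with degenerate wedge.**  Fix `n > 3k ≥ 3` and `θ ≠ 0` with `x^n - θ`
irreducible over ℚ.  Given `b ∈ ℤ^n \ {0}`, let `L ⊆ ℝ^n` be a linear subspace such that for
every `x ∈ L` the `2k` vectors `T^0 x, …, T^{k-1} x, T^0 b, …, T^{k-1} b` span a subspace of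
dimension `< 2k` (i.e. are linearly dependent, equivalently all `2k×2k` minors vanish).
Then `dim L ≤ k`. -/
theorem stmt_3 (n k : ℕ) (hk : 1 ≤ k) (hnk : 3 * k < n) (θ : ℤ) (hθ : θ ≠ 0)
    (hirr : Irreducible ((Polynomial.X : Polynomial ℚ) ^ n - Polynomial.C (θ : ℚ)))
    (b : Fin n → ℤ) (hb : b ≠ 0)
    (L : Submodule ℝ (Fin n → ℝ))
    (hL : ∀ x ∈ L, ¬ LinearIndependent ℝ (fun i : Fin (2 * k) =>
      if (i : ℕ) < k then (Tmap n θ)^[(i : ℕ)] x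
      else (Tmap n θ)^[(i : ℕ) - k] (fun t => ((b t : ℝ))))) :
    Module.finrank ℝ L ≤ k := by
  have hn : 0 < n := by omega
  have : Nonempty (Fin n) := ⟨⟨0, hn⟩⟩
  have hli := linearIndependent_shiftLin_pow_real θ hirr hn hb
  let B := basisOfLinearIndependentOfCardEqFinrank hli (by simp)
  have hB : ∀ i : Fin n, B i = (shiftLin ℝ n (θ : ℝ) ^ (i : ℕ)) (fun t => (b t : ℝ)) := by
    intro i
    simp [B]
  let ψ : L →ₗ[ℝ] ℝ := B.coord ⟨0, hn⟩ ∘ₗ L.subtype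
  let φ : ℕ → LinearMap.ker ψ →ₗ[ℝ] ℝ := fun i =>
    (if h : i + 1 < n then B.coord ⟨i + 1, h⟩ else 0) ∘ₗ L.subtype ∘ₗ (LinearMap.ker ψ).subtype
  have hφ : ∀ i v, φ i v = if h : i + 1 < n then B.repr (v : L) ⟨i + 1, h⟩ else 0 := by
    intro i v
    by_cases h : i + 1 < n <;> simp [φ, h]
  have hker : Module.finrank ℝ (LinearMap.ker ψ) < k := by
    refine finrank_lt_of_forall_window_relation (V := LinearMap.ker ψ) k (n - 1) hk (by omega) φ ?_ ?_
    · intro v hv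
      have h0 : B.repr (v : L) = 0 := by
        ext i
        obtain ⟨i, hi⟩ := i
        cases i with
        | zero => exact LinearMap.mem_ker.1 v.2
        | succ i =>
          have := hv i (by omega)
          rwa [hφ, dif_pos hi] at this
      simpa using h0
    · intro v
      have hx := hL (v : L) (v : L).2
      simp only [Tmap_iterate] at hx
      simp only [hφ]
      exact exists_window_relation hk hnk (θ : ℝ) _ B hB _ hx
  have hrk := ψ.finrank_range_add_finrank_ker
  have hrange : Module.finrank ℝ (LinearMap.range ψ) ≤ 1 :=
    (Submodule.finrank_le _).trans (by simp)
  omega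
end

section
/- Let K = ℚ(θ^{1/n}) with x^n − θ irreducible, n > k ≥ 1, and let N_K(x) = N_{K/ℚ}(Σ_{i=1}^{n−k} x_i θ^{(i−1)/n}), assumed irreducible over ℚ. Then for all primes p not dividing the discriminant of K, #{x ∈ [1,p^2]^{n−k} : p^2 | N_K(x)} ≪ p^{2n−2k−2}, where the implied constant depends only on n, k, θ. -/
open Polynomial in
theorem Polynomial.Monic.exists_mul_add_mul_derivative_eq_C {R : Type*} [CommRing R] [IsDomain R]
    [IsIntegrallyClosed R] [CharZero R] {f : R[X]} (hf : f.Monic) (hirr : Irreducible f) :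
    ∃ a b : R[X], ∃ r : R, r ≠ 0 ∧ a * f + b * derivative f = C r := by
  let L := FractionRing R
  have : CharZero L := charZero_of_injective_algebraMap (IsFractionRing.injective R L)
  have hL : Irreducible (f.map (algebraMap R L)) :=
    (hf.irreducible_iff_irreducible_map_fraction_map (K := L)).1 hirr
  have hsep : IsCoprime (f.map (algebraMap R L)) (derivative f |>.map (algebraMap R L)) := by
    simpa [Polynomial.Separable, derivative_map] using hL.separable
  have hdeg : f.natDegree ≠ 0 := fun h => hirr.not_isUnit (by
    rw [hf.natDegree_eq_zero.1 h]; exact isUnit_one)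
  obtain ⟨a, b, -, -, h⟩ := exists_mul_add_mul_eq_C_resultant f (derivative f)
    le_rfl le_rfl (.inl hdeg)
  refine ⟨a, b, _, fun h0 => resultant_ne_zero _ _ hsep ?_, by rw [← h]; ring⟩
  rw [natDegree_map_eq_of_injective (IsFractionRing.injective R L),
    natDegree_map_eq_of_injective (IsFractionRing.injective R L), resultant_map_map, h0, map_zero]

theorem Nat.eq_of_natCast_zmod_eq_of_div_eq {p x y : ℕ} (hx : 1 ≤ x) (hy : 1 ≤ y)
    (h : (x : ZMod p) = y) (hd : (x - 1) / p = (y - 1) / p) : x = y := by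
  obtain ⟨x, rfl⟩ := Nat.exists_eq_add_of_le' hx
  obtain ⟨y, rfl⟩ := Nat.exists_eq_add_of_le' hy
  simp only [Nat.cast_add, Nat.cast_one, add_left_inj, Nat.add_sub_cancel] at h hd
  rw [ZMod.natCast_eq_natCast_iff'] at h
  rw [← Nat.div_add_mod x p, h, hd, Nat.div_add_mod]

open Finset in
theorem card_piFinset_filter_natCast_zmod_mem_le {m p : ℕ} (hp : p ≠ 0)
    (T : Finset (Fin m → ZMod p)) :
    #{y ∈ Fintype.piFinset fun _ : Fin m => Icc 1 (p ^ 2) | (fun i => ((y i : ℕ) : ZMod p)) ∈ T}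
      ≤ #T * p ^ m := by
  rw [show #T * p ^ m = #(T ×ˢ Fintype.piFinset fun _ : Fin m => range p) by simp]
  refine card_le_card_of_injOn (fun y => (fun i => ((y i : ℕ) : ZMod p), fun i => (y i - 1) / p))
    ?_ ?_
  · intro y hy
    simp only [coe_filter, Fintype.mem_piFinset, mem_Icc, Set.mem_ofPred_eq] at hy
    simp only [coe_product, Set.mem_prod, mem_coe, hy.2, Fintype.mem_piFinset, mem_range,
      true_and]
    intro i
    have := hy.1 i
    rw [Nat.div_lt_iff_lt_mul (Nat.pos_of_ne_zero hp), ← sq]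
    lia
  · intro y hy z hz h
    simp only [coe_filter, Fintype.mem_piFinset, mem_Icc, Set.mem_ofPred_eq] at hy hz
    simp only [Prod.mk.injEq, funext_iff] at h
    exact funext fun i =>
      Nat.eq_of_natCast_zmod_eq_of_div_eq (hy.1 i).1 (hz.1 i).1 (h.1 i) (h.2 i)

open Finset in
theorem card_filter_natCast_zmod_mem_le {p : ℕ} (hp : p ≠ 0) (T : Finset (ZMod p)) :
    #{x ∈ Icc 1 (p ^ 2) | ((x : ℕ) : ZMod p) ∈ T} ≤ #T * p := by
  rw [show #T * p = #(T ×ˢ range p) by simp]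
  refine card_le_card_of_injOn (fun x => ((x : ZMod p), (x - 1) / p)) ?_ ?_
  · intro x hx
    simp only [coe_filter, mem_Icc, Set.mem_ofPred_eq] at hx
    simp only [coe_product, Set.mem_prod, mem_coe, hx.2, mem_range, true_and]
    rw [Nat.div_lt_iff_lt_mul (Nat.pos_of_ne_zero hp), ← sq]
    lia
  · intro x hx y hy h
    simp only [coe_filter, mem_Icc, Set.mem_ofPred_eq] at hx hy
    simp only [Prod.mk.injEq] at h
    exact Nat.eq_of_natCast_zmod_eq_of_div_eq hx.1.1 hy.1.1 h.1 h.2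

open Polynomial in
theorem Polynomial.natCast_mem_roots_map_zmod {p : ℕ} [Fact p.Prime] {g : ℤ[X]} (hg : g.Monic)
    {x : ℕ} (hx : (p : ℤ) ∣ g.eval (x : ℤ)) :
    (x : ZMod p) ∈ (g.map (Int.castRingHom (ZMod p))).roots.toFinset := by
  rw [Multiset.mem_toFinset, mem_roots (hg.map _).ne_zero, IsRoot, ← Int.cast_natCast,
    ← eq_intCast (Int.castRingHom (ZMod p)), eval_map_apply, eq_intCast,
    ZMod.intCast_zmod_eq_zero_iff_dvd]
  exact hx

open Polynomial in
theorem Polynomial.card_roots_map_zmod_toFinset_le {p : ℕ} [Fact p.Prime] (g : ℤ[X]) :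
    (g.map (Int.castRingHom (ZMod p))).roots.toFinset.card ≤ g.natDegree :=
  (Multiset.toFinset_card_le _).trans <| (card_roots' _).trans natDegree_map_le

open Polynomial Finset in
theorem Polynomial.card_sq_dvd_eval_le_mul {p : ℕ} [Fact p.Prime] {g : ℤ[X]} (hg : g.Monic) :
    #{x ∈ Icc 1 (p ^ 2) | (p : ℤ) ^ 2 ∣ g.eval ((x : ℕ) : ℤ)} ≤ g.natDegree * p :=
  calc
    _ ≤ #{x ∈ Icc 1 (p ^ 2) |
          ((x : ℕ) : ZMod p) ∈ (g.map (Int.castRingHom (ZMod p))).roots.toFinset} :=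
      card_le_card <| monotone_filter_right _ fun _ _ hx =>
        natCast_mem_roots_map_zmod hg ((dvd_pow_self _ two_ne_zero).trans hx)
    _ ≤ _ := card_filter_natCast_zmod_mem_le (Fact.out : p.Prime).ne_zero _
    _ ≤ _ := Nat.mul_le_mul_right _ (card_roots_map_zmod_toFinset_le g)

open Polynomial in
theorem Polynomial.sq_dvd_sub_of_sq_dvd_eval {p : ℕ} (hp : p.Prime) {g a b : ℤ[X]} {r : ℤ}
    (hr : ¬ (p : ℤ) ∣ r) (h : a * g + b * derivative g = C r) {x y : ℤ}
    (hx : (p : ℤ) ^ 2 ∣ g.eval x) (hy : (p : ℤ) ^ 2 ∣ g.eval y) (hxy : (p : ℤ) ∣ y - x) :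
    (p : ℤ) ^ 2 ∣ y - x := by
  obtain ⟨k, hk⟩ := g.binomExpansion x (y - x)
  have hprime : Prime (p : ℤ) := Nat.prime_iff_prime_int.1 hp
  have hd : ¬ (p : ℤ) ∣ (derivative g).eval x := fun hd => hr <| by
    have := congrArg (eval x) h
    simp only [eval_add, eval_mul, eval_C] at this
    rw [← this]
    exact dvd_add (((dvd_pow_self _ two_ne_zero).trans hx).mul_left _) (hd.mul_left _)
  have hcop : IsCoprime ((p : ℤ) ^ 2) ((derivative g).eval x) :=
    (hprime.irreducible.coprime_iff_not_dvd.2 hd).pow_left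
  refine hcop.dvd_of_dvd_mul_left ?_
  rw [add_sub_cancel] at hk
  have : (derivative g).eval x * (y - x) = g.eval y - g.eval x - k * (y - x) ^ 2 := by
    rw [hk]; ring
  rw [this]
  exact (hy.sub hx).sub ((pow_dvd_pow_of_dvd hxy 2).mul_left _)

open Polynomial Finset in
theorem Polynomial.card_sq_dvd_eval_le_natDegree {p : ℕ} [Fact p.Prime] {g a b : ℤ[X]} {r : ℤ}
    (hg : g.Monic) (hr : ¬ (p : ℤ) ∣ r) (h : a * g + b * derivative g = C r) :
    #{x ∈ Icc 1 (p ^ 2) | (p : ℤ) ^ 2 ∣ g.eval ((x : ℕ) : ℤ)} ≤ g.natDegree := by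
  refine le_trans ?_ (card_roots_map_zmod_toFinset_le (p := p) g)
  refine card_le_card_of_injOn (fun x => (x : ZMod p)) ?_ ?_
  · intro x hx
    simp only [coe_filter, mem_Icc, Set.mem_ofPred_eq] at hx
    exact natCast_mem_roots_map_zmod hg ((dvd_pow_self _ two_ne_zero).trans hx.2)
  · intro x hx y hy hxy
    simp only [coe_filter, mem_Icc, Set.mem_ofPred_eq] at hx hy
    rw [ZMod.natCast_eq_natCast_iff, Nat.modEq_iff_dvd] at hxy
    have := sq_dvd_sub_of_sq_dvd_eval Fact.out hr h hx.2 hy.2 hxy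
    have h0 := Int.eq_zero_of_abs_lt_dvd this (by
      have hx' : (x : ℤ) ≤ (p : ℤ) ^ 2 := by exact_mod_cast hx.1.2
      have hy' : (y : ℤ) ≤ (p : ℤ) ^ 2 := by exact_mod_cast hy.1.2
      rw [abs_lt]; lia)
    lia

open Finset in
theorem MvPolynomial.card_dvd_eval_mul_le {m p : ℕ} [Fact p.Prime] (r : MvPolynomial (Fin m) ℤ)
    (hr : r.map (Int.castRingHom (ZMod p)) ≠ 0) :
    #{y ∈ Fintype.piFinset fun _ : Fin m => Icc 1 (p ^ 2) |
      (p : ℤ) ∣ eval (fun i => ((y i : ℕ) : ℤ)) r} * p ≤ r.totalDegree * p ^ (2 * m) := by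
  have hp0 : 0 < p := (Fact.out : p.Prime).pos
  set r' := r.map (Int.castRingHom (ZMod p))
  set T : Finset (Fin m → ZMod p) := {z | eval z r' = 0}
  have hT : #T * p ≤ r.totalDegree * p ^ m := by
    have hsz := schwartz_zippel_totalDegree hr (univ : Finset (ZMod p))
    rw [card_univ, ZMod.card, Fintype.piFinset_univ, div_le_div_iff₀ (by positivity)
      (by positivity)] at hsz
    have : #T * p ≤ r'.totalDegree * p ^ m := by exact_mod_cast hsz
    exact this.trans (Nat.mul_le_mul_right _ (sup_mono (support_map_subset _ _)))
  have hsub : #{y ∈ Fintype.piFinset fun _ : Fin m => Icc 1 (p ^ 2) |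
      (p : ℤ) ∣ eval (fun i => ((y i : ℕ) : ℤ)) r} ≤ #T * p ^ m := by
    refine (card_le_card (monotone_filter_right _ fun y _ hy => ?_)).trans
      (card_piFinset_filter_natCast_zmod_mem_le hp0.ne' T)
    rw [← ZMod.intCast_zmod_eq_zero_iff_dvd, ← eq_intCast (Int.castRingHom (ZMod p)),
      eval₂_comp] at hy
    simpa [T, r', eval_map, Function.comp_def] using hy
  calc
    _ ≤ #T * p ^ m * p := Nat.mul_le_mul_right _ hsub
    _ = #T * p * p ^ m := by ring
    _ ≤ r.totalDegree * p ^ m * p ^ m := Nat.mul_le_mul_right _ hT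
    _ = _ := by ring

open Polynomial Finset in
theorem Polynomial.Monic.exists_card_sq_dvd_eval_le {m : ℕ} {f : (MvPolynomial (Fin m) ℤ)[X]}
    (hf : f.Monic) (hirr : Irreducible f) :
    ∃ N : ℕ, ∀ p : ℕ, p.Prime →
      #{z ∈ Icc 1 (p ^ 2) ×ˢ Fintype.piFinset fun _ : Fin m => Icc 1 (p ^ 2) | (p : ℤ) ^ 2 ∣
        (f.map (MvPolynomial.eval fun i => ((z.2 i : ℕ) : ℤ))).eval (z.1 : ℤ)} ≤
        N * p ^ (2 * m) := by
  obtain ⟨a, b, r, hr0, hab⟩ := hf.exists_mul_add_mul_derivative_eq_C hirr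
  obtain ⟨d, hd⟩ := MvPolynomial.ne_zero_iff.1 hr0
  set n := f.natDegree
  refine ⟨n + n * r.totalDegree + n * (r.coeff d).natAbs, fun p hp => ?_⟩
  have : Fact p.Prime := ⟨hp⟩
  set J : Finset (Fin m → ℕ) := Fintype.piFinset fun _ : Fin m => Icc 1 (p ^ 2) with hJ
  have hJcard : #J = p ^ (2 * m) := by simp [hJ, pow_mul]
  let g (y : Fin m → ℕ) : ℤ[X] := f.map (MvPolynomial.eval fun i => (y i : ℤ))
  have hg (y) : (g y).Monic := hf.map _
  have hgdeg (y) : (g y).natDegree = n := hf.natDegree_map _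
  have hsum : #{z ∈ Icc 1 (p ^ 2) ×ˢ J | (p : ℤ) ^ 2 ∣ (g z.2).eval (z.1 : ℤ)} =
      ∑ y ∈ J, #{x ∈ Icc 1 (p ^ 2) | (p : ℤ) ^ 2 ∣ (g y).eval ((x : ℕ) : ℤ)} := by
    simp only [card_filter, sum_product_right]
  change #{z ∈ Icc 1 (p ^ 2) ×ˢ J | (p : ℤ) ^ 2 ∣ (g z.2).eval (z.1 : ℤ)} ≤ _
  rw [hsum]
  have htriv (y) : #{x ∈ Icc 1 (p ^ 2) | (p : ℤ) ^ 2 ∣ (g y).eval ((x : ℕ) : ℤ)} ≤ n * p :=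
    hgdeg y ▸ card_sq_dvd_eval_le_mul (hg y)
  by_cases hpd : (p : ℤ) ∣ r.coeff d
  · have hple : p ≤ (r.coeff d).natAbs :=
      Nat.le_of_dvd (Int.natAbs_pos.2 hd) (Int.natCast_dvd.1 hpd)
    calc
      _ ≤ ∑ _y ∈ J, n * p := sum_le_sum fun y _ => htriv y
      _ = n * p * p ^ (2 * m) := by rw [sum_const, hJcard, smul_eq_mul, mul_comm]
      _ ≤ _ := Nat.mul_le_mul_right _ <|
        (Nat.mul_le_mul_left n hple).trans (Nat.le_add_left _ _)
  · have hrp : r.map (Int.castRingHom (ZMod p)) ≠ 0 := MvPolynomial.ne_zero_iff.2 ⟨d, by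
      rwa [MvPolynomial.coeff_map, eq_intCast, Ne, ZMod.intCast_zmod_eq_zero_iff_dvd]⟩
    have hbez (y) : (a.map (MvPolynomial.eval fun i => ((y i : ℕ) : ℤ))) * g y +
        (b.map (MvPolynomial.eval fun i => (y i : ℤ))) * derivative (g y) =
        C (MvPolynomial.eval (fun i => (y i : ℤ)) r) := by
      simp only [g, derivative_map, ← Polynomial.map_mul, ← Polynomial.map_add, hab, map_C]
    have hfib (y) : #{x ∈ Icc 1 (p ^ 2) | (p : ℤ) ^ 2 ∣ (g y).eval ((x : ℕ) : ℤ)} ≤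
        n + if (p : ℤ) ∣ MvPolynomial.eval (fun i => ((y i : ℕ) : ℤ)) r then n * p else 0 := by
      split_ifs with hy
      · exact (htriv y).trans (Nat.le_add_left _ _)
      · exact hgdeg y ▸ card_sq_dvd_eval_le_natDegree (hg y) hy (hbez y)
    calc
      _ ≤ ∑ y ∈ J, (n + if (p : ℤ) ∣ MvPolynomial.eval (fun i => ((y i : ℕ) : ℤ)) r
            then n * p else 0) := sum_le_sum fun y _ => hfib y
      _ = n * p ^ (2 * m) +
          n * (#{y ∈ J | (p : ℤ) ∣ MvPolynomial.eval (fun i => ((y i : ℕ) : ℤ)) r} * p) := by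
        rw [sum_add_distrib, sum_const, hJcard, ← sum_filter, sum_const, smul_eq_mul, smul_eq_mul]
        ring
      _ ≤ n * p ^ (2 * m) + n * (r.totalDegree * p ^ (2 * m)) :=
        Nat.add_le_add_left (Nat.mul_le_mul_left _ (r.card_dvd_eval_mul_le hrp)) _
      _ = (n + n * r.totalDegree) * p ^ (2 * m) := by ring
      _ ≤ _ := Nat.mul_le_mul_right _ (Nat.le_add_right _ _)

theorem Algebra.exists_monic_eval_eq_norm {R S : Type*} [CommRing R] [CommRing S] [Algebra R S]
    [Module.Free R S] [Module.Finite R S] {m : ℕ} (a : Fin m → S) :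
    ∃ f : Polynomial (MvPolynomial (Fin m) R), f.Monic ∧ ∀ (x : R) (y : Fin m → R),
      (f.map (MvPolynomial.eval y)).eval x =
        Algebra.norm R (algebraMap R S x + ∑ i, y i • a i) := by
  classical
  let b := Module.Free.chooseBasis R S
  refine ⟨(-∑ i, (MvPolynomial.X i : MvPolynomial (Fin m) R) •
    (Algebra.leftMulMatrix b (a i)).map MvPolynomial.C).charpoly,
    Matrix.charpoly_monic _, fun x y => ?_⟩
  rw [← Matrix.charpoly_map, Matrix.eval_charpoly, Algebra.norm_eq_matrix_det b]
  congr 1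
  rw [map_add, AlgHom.commutes, map_sum, sub_eq_add_neg]
  congr 1
  ext i j
  simp [Matrix.sum_apply]

theorem MvPolynomial.irreducible_of_eval_finSucc_eq {m : ℕ} {P : MvPolynomial (Fin (m + 1)) ℚ}
    (hP : Irreducible P) {f : Polynomial (MvPolynomial (Fin m) ℤ)} (hf : f.Monic)
    (h : ∀ x : Fin (m + 1) → ℤ, eval (fun i => (x i : ℚ)) P =
      ((f.map (eval fun i => x i.succ)).eval (x 0) : ℤ)) : Irreducible f := by
  refine hf.irreducible_of_irreducible_map (map (Int.castRingHom ℚ)) _ ?_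
  rw [← MulEquiv.irreducible_iff (finSuccEquiv ℚ m).symm]
  convert hP using 1
  refine funext_set (fun _ => Set.range ((↑) : ℤ → ℚ))
    (fun _ => Set.infinite_range_of_injective Int.cast_injective) fun x hx => ?_
  choose z hz using fun i => hx i trivial
  obtain rfl : (fun i => (z i : ℚ)) = x := _root_.funext hz
  rw [h]
  nth_rw 1 [← Fin.cons_self_tail fun i => (z i : ℚ)]
  rw [eval_eq_eval_mv_eval', AlgEquiv.apply_symm_apply, Polynomial.map_map]
  have : (eval (Fin.tail fun i => (z i : ℚ))).comp (map (Int.castRingHom ℚ)) =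
      (Int.castRingHom ℚ).comp (eval fun i => z i.succ) := by
    ext <;> simp [Fin.tail]
  rw [this, ← Polynomial.map_map, ← eq_intCast (Int.castRingHom ℚ) (z 0),
    Polynomial.eval_map_apply, eq_intCast]

open Finset in
theorem NumberField.exists_card_sq_dvd_norm_le {K : Type*} [Field K] [NumberField K]
    (α : RingOfIntegers K) {m : ℕ} (P : MvPolynomial (Fin (m + 1)) ℚ)
    (hP : ∀ x : Fin (m + 1) → ℚ,
      MvPolynomial.eval x P = Algebra.norm ℚ (∑ i, x i • (α : K) ^ (i : ℕ)))
    (hirr : Irreducible P) :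
    ∃ N : ℕ, ∀ p : ℕ, p.Prime →
      Nat.card {x : Fin (m + 1) → ℕ | (∀ i, 1 ≤ x i ∧ x i ≤ p ^ 2) ∧
        (p : ℤ) ^ 2 ∣ Algebra.norm ℤ (∑ i, (x i : RingOfIntegers K) * α ^ (i : ℕ))} ≤
        N * p ^ (2 * m) := by
  obtain ⟨f, hf, hnorm⟩ := Algebra.exists_monic_eval_eq_norm (R := ℤ)
    (fun i : Fin m => α ^ ((i : ℕ) + 1))
  have hnorm' (x : Fin (m + 1) → ℤ) : (f.map (MvPolynomial.eval fun i => x i.succ)).eval (x 0) =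
      Algebra.norm ℤ (∑ i, (x i : RingOfIntegers K) * α ^ (i : ℕ)) := by
    rw [hnorm, Fin.sum_univ_succ]
    simp
  have hfirr : Irreducible f := MvPolynomial.irreducible_of_eval_finSucc_eq hirr hf fun x => by
    rw [hnorm', hP, Algebra.coe_norm_int]
    simp [Algebra.smul_def]
  obtain ⟨N, hN⟩ := hf.exists_card_sq_dvd_eval_le hfirr
  refine ⟨N, fun p hp => (hN p hp).trans' ?_⟩
  rw [Nat.card_coe_set_eq, ← Set.ncard_coe_finset]
  refine Set.ncard_le_ncard_of_injOn (fun x => (x 0, Fin.tail x)) ?_ ?_ (Finset.finite_toSet _)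
  · rintro x ⟨hx, hdvd⟩
    have := hnorm' fun i => (x i : ℤ)
    simp only [Int.cast_natCast] at this
    rw [← this] at hdvd
    simpa [Fin.tail, hx] using hdvd
  · intro x _ y _ hxy
    rw [← Fin.cons_self_tail x, ← Fin.cons_self_tail y, (Prod.mk.inj hxy).1, (Prod.mk.inj hxy).2]

/-- **Solutions of `p² ∣ N_K(x)` are rare.**  Let `K = ℚ(θ^{1/n})` with `x^n - θ` irreducible,
`n > k ≥ 1`, and suppose the incomplete norm form `N_K(x) = N_{K/ℚ}(∑ xᵢ θ^{(i-1)/n})` is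
irreducible over ℚ (as the multivariate polynomial `P`).  Then there is `C = C(n,k,θ)` such
that for every prime `p` not dividing the discriminant of `K`,
`#{x ∈ [1,p²]^{n-k} : p² ∣ N_K(x)} ≤ C · p^{2n-2k-2}`. -/
theorem stmt_7 (n k : ℕ) (hk : 1 ≤ k) (hkn : k < n) (θ : ℤ)
    (hirr : Irreducible ((Polynomial.X : Polynomial ℚ) ^ n - Polynomial.C (θ : ℚ)))
    (K : Type*) [Field K] [NumberField K] (hdeg : Module.finrank ℚ K = n)
    (α : NumberField.RingOfIntegers K) (hα : ((α : K)) ^ n = (θ : K))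
    (hgen : Algebra.adjoin ℚ {((α : K))} = ⊤)
    (P : MvPolynomial (Fin (n - k)) ℚ)
    (hP : ∀ x : Fin (n - k) → ℚ,
      MvPolynomial.eval x P = Algebra.norm ℚ (∑ i, x i • ((α : K)) ^ (i : ℕ)))
    (hPirr : Irreducible P) :
    ∃ C : ℝ, 0 < C ∧ ∀ p : ℕ, p.Prime → ¬ ((p : ℤ) ∣ NumberField.discr K) →
      (Nat.card {x : Fin (n - k) → ℕ | (∀ i, 1 ≤ x i ∧ x i ≤ p ^ 2) ∧
          (p : ℤ) ^ 2 ∣ Algebra.norm ℤ (∑ i, (x i : NumberField.RingOfIntegers K) * α ^ (i : ℕ))} : ℝ)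
        ≤ C * (p : ℝ) ^ (2 * n - 2 * k - 2) := by
  obtain ⟨m, hm⟩ : ∃ m, n - k = m + 1 := ⟨n - k - 1, by lia⟩
  rw [show 2 * n - 2 * k - 2 = 2 * m by lia]
  generalize n - k = d at *
  subst hm
  obtain ⟨N, hN⟩ := NumberField.exists_card_sq_dvd_norm_le α P hP hPirr
  refine ⟨N + 1, by positivity, fun p hp _ => ?_⟩
  have h := (hN p hp).trans (Nat.mul_le_mul_right _ N.le_succ)
  exact_mod_cast h
end

section
/- Let K = ℚ(θ^{1/n}) with x^n − θ irreducible and n > k ≥ 1 and fix e > 0. Then Σ_{x ∈ ℤ^{n−k}, ‖x‖ ≤ X} τ((Σ_{i=1}^{n−k} x_i θ^{(i−1)/n}))^e ≪ X^{n−k} (log X)^{O_e(1)}, where τ(α) is the number of ideal divisors of the principal ideal (α), and the implied constants depend only on n, k, θ, e. -/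
/-- The number of divisors of an element of a monoid. -/
noncomputable def numDivisors {M : Type*} [Monoid M] (a : M) : ℕ := Nat.card {b : M | b ∣ a}

section NumDivisors

variable {M : Type*} [CommMonoidWithZero M] [UniqueFactorizationMonoid M] [Subsingleton Mˣ]

theorem finite_setOf_dvd {a : M} (ha : a ≠ 0) : {b : M | b ∣ a}.Finite := by
  have : Fintype Mˣ := Fintype.ofSubsingleton 1
  have := UniqueFactorizationMonoid.fintypeSubtypeDvd a ha
  exact (Set.finite_coe_iff (s := {b : M | b ∣ a})).mp (Finite.of_fintype {b : M // b ∣ a})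

theorem one_le_numDivisors {a : M} (ha : a ≠ 0) : 1 ≤ numDivisors a := by
  have := (finite_setOf_dvd ha).to_subtype
  have : Nonempty {b : M | b ∣ a} := ⟨⟨a, dvd_refl a⟩⟩
  exact Nat.card_pos

theorem numDivisors_le_of_dvd {a b : M} (hb : b ≠ 0) (h : a ∣ b) :
    numDivisors a ≤ numDivisors b :=
  Nat.card_mono (finite_setOf_dvd hb) fun _ hc => dvd_trans hc h

theorem numDivisors_mul_le {a b : M} (ha : a ≠ 0) (hb : b ≠ 0) :
    numDivisors (a * b) ≤ numDivisors a * numDivisors b := by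
  have := (finite_setOf_dvd ha).to_subtype
  have := (finite_setOf_dvd hb).to_subtype
  rw [numDivisors, numDivisors, numDivisors, ← Nat.card_prod]
  refine Nat.card_le_card_of_surjective
    (fun p : {c : M | c ∣ a} × {c : M | c ∣ b} =>
      (⟨p.1 * p.2, mul_dvd_mul p.1.2 p.2.2⟩ : {c : M | c ∣ a * b})) ?_
  rintro ⟨c, hc⟩
  obtain ⟨c₁, c₂, h₁, h₂, rfl⟩ := exists_dvd_and_dvd_of_dvd_mul hc
  exact ⟨(⟨c₁, h₁⟩, ⟨c₂, h₂⟩), rfl⟩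

theorem numDivisors_prime_pow_le {p : M} (hp : Prime p) (j : ℕ) :
    numDivisors (p ^ j) ≤ j + 1 := by
  have := (Nat.card_le_card_of_surjective
    (fun i : Fin (j + 1) => (⟨p ^ (i : ℕ), pow_dvd_pow p (Nat.le_of_lt_succ i.2)⟩ :
      {c : M | c ∣ p ^ j}))) ?_
  · rwa [Nat.card_fin] at this
  rintro ⟨c, hc⟩
  obtain ⟨i, hi, h⟩ := (dvd_prime_pow hp j).mp hc
  exact ⟨⟨i, Nat.lt_succ_of_le hi⟩, Subtype.ext (associated_iff_eq.mp h).symm⟩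

theorem numDivisors_one [Nontrivial M] : numDivisors (1 : M) = 1 := by
  refine le_antisymm ?_ (one_le_numDivisors one_ne_zero)
  have : Subsingleton {b : M | b ∣ 1} := ⟨fun a b => Subtype.ext
    ((isUnit_iff_eq_one.mp (isUnit_of_dvd_one a.2)).trans
      (isUnit_iff_eq_one.mp (isUnit_of_dvd_one b.2)).symm)⟩
  exact Finite.card_le_one_iff_subsingleton.mpr this

theorem numDivisors_multiset_prod_pow_le [Nontrivial M] (s : Multiset M) (hs : ∀ p ∈ s, Prime p)
    (j : ℕ) : numDivisors (s.prod ^ j) ≤ (j + 1) ^ s.card := by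
  induction s using Multiset.induction_on with
  | empty => simp [numDivisors_one]
  | cons p s ih =>
    have hs' : ∀ q ∈ s, Prime q := fun q hq => hs q (Multiset.mem_cons_of_mem hq)
    have hp := hs p (Multiset.mem_cons_self p s)
    have h0 : s.prod ≠ 0 := Multiset.prod_ne_zero fun h => (hs' 0 h).ne_zero rfl
    rw [Multiset.prod_cons, mul_pow, Multiset.card_cons, pow_succ']
    exact (numDivisors_mul_le (pow_ne_zero _ hp.ne_zero) (pow_ne_zero _ h0)).trans
      (Nat.mul_le_mul (numDivisors_prime_pow_le hp j) (ih hs'))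

end NumDivisors

/-- The sum `∑_{b ≤ N} τ(b)^m / b` is at most a power of the corresponding harmonic sum. -/
theorem sum_card_divisors_pow_div_le (N m : ℕ) :
    ∑ b ∈ Finset.Icc 1 N, ((b.divisors.card : ℝ) ^ m / b) ≤
      (∑ b ∈ Finset.Icc 1 N, (1 / b : ℝ)) ^ 2 ^ m := by
  induction m with
  | zero => simp
  | succ m ih =>
    have hnn : 0 ≤ ∑ b ∈ Finset.Icc 1 N, ((b.divisors.card : ℝ) ^ m / b) :=
      Finset.sum_nonneg fun _ _ => by positivity
    rw [pow_succ 2 m, pow_mul, sq]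
    refine le_trans ?_ (mul_le_mul ih ih hnn (hnn.trans ih))
    rw [Finset.sum_mul_sum, ← Finset.sum_product']
    have hmaps : ∑ b ∈ Finset.Icc 1 N, ((b.divisors.card : ℝ) ^ (m + 1) / b) ≤
        ∑ x ∈ (Finset.Icc 1 N).sigma fun b => b.divisorsAntidiagonal,
          ((x.2.1.divisors.card : ℝ) ^ m / x.2.1 * ((x.2.2.divisors.card : ℝ) ^ m / x.2.2)) := by
      rw [Finset.sum_sigma]
      refine Finset.sum_le_sum fun b hb => ?_
      have hcard : (b.divisors.card : ℝ) = b.divisorsAntidiagonal.card := by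
        rw [← Nat.map_div_right_divisors, Finset.card_map]
      have : (b.divisors.card : ℝ) ^ (m + 1) / b =
          ∑ _x ∈ b.divisorsAntidiagonal, (b.divisors.card : ℝ) ^ m / b := by
        rw [Finset.sum_const, nsmul_eq_mul, ← hcard]; ring
      rw [this]
      refine Finset.sum_le_sum fun x hx => ?_
      obtain ⟨hx, -⟩ := Nat.mem_divisorsAntidiagonal.mp hx
      rw [div_mul_div_comm, ← mul_pow, ← Nat.cast_mul x.1, hx]
      gcongr
      rw [← hx, Nat.divisors_mul]
      exact_mod_cast Finset.card_mul_le
    refine hmaps.trans ?_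
    rw [← Finset.sum_image (f := fun x : ℕ × ℕ =>
      ((x.1.divisors.card : ℝ) ^ m / x.1 * ((x.2.divisors.card : ℝ) ^ m / x.2)))
      (g := fun x : (_ : ℕ) × ℕ × ℕ => x.2)]
    · refine Finset.sum_le_sum_of_subset_of_nonneg ?_ fun _ _ _ => by positivity
      intro y hy
      obtain ⟨⟨b, x⟩, hx, rfl⟩ := Finset.mem_image.mp hy
      simp only [Finset.mem_sigma, Finset.mem_Icc, Nat.mem_divisorsAntidiagonal] at hx
      obtain ⟨⟨h1, hN⟩, h, h0⟩ := hx
      have h₁ : 0 < x.1 := Nat.pos_of_ne_zero (by rintro h'; simp [h'] at h; omega)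
      have h₂ : 0 < x.2 := Nat.pos_of_ne_zero (by rintro h'; simp [h'] at h; omega)
      simp only [Finset.mem_product, Finset.mem_Icc]
      refine ⟨⟨h₁, ?_⟩, h₂, ?_⟩ <;> nlinarith
    · rintro ⟨b, x⟩ hx ⟨b', x'⟩ hx' h
      simp only [Finset.coe_sigma, Set.mem_sigma_iff, Finset.mem_coe,
        Nat.mem_divisorsAntidiagonal] at hx hx' h
      subst h
      obtain rfl : b = b' := hx.2.1.symm.trans hx'.2.1
      rfl

theorem sum_card_divisors_pow_div_le_log (N m : ℕ) :
    ∑ b ∈ Finset.Icc 1 N, ((b.divisors.card : ℝ) ^ m / b) ≤ (1 + Real.log N) ^ 2 ^ m := by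
  refine (sum_card_divisors_pow_div_le N m).trans ?_
  gcongr
  have := harmonic_le_one_add_log N
  rw [harmonic_eq_sum_Icc] at this
  simpa using this

section Ideals

open NumberField

/-- The nonnegative generator of the contraction of an ideal to `ℤ`. -/
noncomputable def contractionGen {K : Type*} [Field K] (I : Ideal (𝓞 K)) : ℕ :=
  Ideal.absNorm (I.comap (algebraMap ℤ (𝓞 K)))

theorem contractionGen_dvd_iff {K : Type*} [Field K] (I : Ideal (𝓞 K)) (m : ℤ) :
    (contractionGen I : ℤ) ∣ m ↔ (m : 𝓞 K) ∈ I := by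
  rw [← Ideal.mem_span_singleton, contractionGen, Int.ideal_span_absNorm_eq_self, Ideal.mem_comap]
  simp

variable {K : Type*} [Field K] [NumberField K]

theorem absNorm_pos {I : Ideal (𝓞 K)} (hI : I ≠ 0) : 0 < Ideal.absNorm I :=
  Nat.pos_of_ne_zero fun h => hI (Ideal.absNorm_eq_zero_iff.mp h)

theorem one_lt_absNorm {I : Ideal (𝓞 K)} (hI : Prime I) : 1 < Ideal.absNorm I := by
  have h2 := absNorm_pos hI.ne_zero
  have h3 : Ideal.absNorm I ≠ 1 := fun h => hI.not_isUnit
    (isUnit_iff_eq_one.mpr ((Ideal.absNorm_eq_one_iff.mp h).trans Ideal.one_eq_top.symm))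
  omega

/-- Divisor switching: an ideal of norm at most `Y ^ k` has a divisor of norm at most `Y`
whose number of divisors controls that of the ideal. -/
theorem exists_dvd_numDivisors_le {Y : ℝ} (hY : 1 ≤ Y) (k : ℕ) :
    ∀ I : Ideal (𝓞 K), I ≠ 0 → (Ideal.absNorm I : ℝ) ≤ Y ^ k →
      ∃ J, J ∣ I ∧ (Ideal.absNorm J : ℝ) ≤ Y ∧ numDivisors I ≤ 2 ^ k * numDivisors J ^ k := by
  induction k with
  | zero =>
    intro I h0 hI
    refine ⟨1, one_dvd _, by simpa using hY, ?_⟩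
    rw [pow_zero, Nat.cast_le_one] at hI
    have : I = 1 := (Ideal.absNorm_eq_one_iff.mp (le_antisymm hI (absNorm_pos h0))).trans
      Ideal.one_eq_top.symm
    rw [this, numDivisors_one, pow_zero, pow_zero, one_mul]
  | succ k ih =>
    intro I h0 hI
    by_cases hIY : (Ideal.absNorm I : ℝ) ≤ Y
    · refine ⟨I, dvd_refl I, hIY, ?_⟩
      have h1 := one_le_numDivisors h0
      calc numDivisors I ≤ numDivisors I ^ (k + 1) := Nat.le_self_pow (by omega) _
        _ ≤ 2 ^ (k + 1) * numDivisors I ^ (k + 1) := Nat.le_mul_of_pos_left _ (by positivity)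
    have hfin : {J : Ideal (𝓞 K) | J ∣ I ∧ (Ideal.absNorm J : ℝ) ≤ Y}.Finite :=
      (finite_setOf_dvd h0).subset fun J hJ => hJ.1
    obtain ⟨c, ⟨hcI, hcY⟩, hmax⟩ := hfin.exists_maximalFor Ideal.absNorm _
      ⟨1, one_dvd _, by simpa using hY⟩
    obtain ⟨I₁, rfl⟩ := hcI
    have hI₁ : I₁ ≠ 0 := right_ne_zero_of_mul h0
    have hc0 : c ≠ 0 := left_ne_zero_of_mul h0
    have hunit : ¬ IsUnit I₁ := fun hu => by
      rw [isUnit_iff_eq_one.mp hu, mul_one] at hIY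
      exact hIY hcY
    obtain ⟨p, hpirr, I', rfl⟩ := WfDvdMonoid.exists_irreducible_factor hunit hI₁
    have hp := hpirr.prime
    have hI' : I' ≠ 0 := right_ne_zero_of_mul hI₁
    have hNc := absNorm_pos hc0
    have hNp := one_lt_absNorm hp
    have hbig : Y < (Ideal.absNorm (c * p) : ℝ) := by
      by_contra! hle
      have := hmax (j := c * p) ⟨⟨I', by rw [mul_assoc]⟩, hle⟩ (by
        rw [map_mul]; exact Nat.le_mul_of_pos_right _ (by omega))
      rw [map_mul] at this
      nlinarith
    have hN' : (Ideal.absNorm I' : ℝ) ≤ Y ^ k := by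
      rw [← mul_assoc, map_mul, Nat.cast_mul, pow_succ'] at hI
      have : Y * (Ideal.absNorm I' : ℝ) ≤ Y * Y ^ k :=
        (mul_le_mul_of_nonneg_right hbig.le (by positivity)).trans hI
      exact le_of_mul_le_mul_left this (by linarith)
    obtain ⟨J, hJ, hJY, hτ⟩ := ih I' hI' hN'
    have hmul : numDivisors (c * (p * I')) ≤
        numDivisors c * (2 * (2 ^ k * numDivisors J ^ k)) := by
      refine (numDivisors_mul_le hc0 hI₁).trans (Nat.mul_le_mul_left _ ?_)
      refine (numDivisors_mul_le hp.ne_zero hI').trans (Nat.mul_le_mul ?_ hτ)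
      simpa using numDivisors_prime_pow_le hp 1
    rcases le_total (numDivisors c) (numDivisors J) with h | h
    · refine ⟨J, (hJ.mul_left p).mul_left c, hJY, hmul.trans ?_⟩
      calc numDivisors c * (2 * (2 ^ k * numDivisors J ^ k))
          ≤ numDivisors J * (2 * (2 ^ k * numDivisors J ^ k)) := by gcongr
        _ = _ := by ring
    · refine ⟨c, dvd_mul_right _ _, hcY, hmul.trans ?_⟩
      calc numDivisors c * (2 * (2 ^ k * numDivisors J ^ k))
          ≤ numDivisors c * (2 * (2 ^ k * numDivisors c ^ k)) := by gcongr
        _ = _ := by ring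

theorem span_natCast_ne_zero {b : ℕ} (hb : b ≠ 0) :
    Ideal.span {(b : 𝓞 K)} ≠ 0 := by
  simpa [Ideal.zero_eq_bot, Ideal.span_singleton_eq_bot] using hb

theorem absNorm_span_natCast (b : ℕ) :
    Ideal.absNorm (Ideal.span {(b : 𝓞 K)}) = b ^ Module.finrank ℚ K := by
  have := Algebra.norm_algebraMap (R := ℤ) (S := 𝓞 K) (b : ℤ)
  rw [Ideal.absNorm_span_singleton, ← RingOfIntegers.rank K]
  simp only [algebraMap_int_eq, eq_intCast, Int.cast_natCast] at this
  rw [this, Int.natAbs_pow, Int.natAbs_natCast]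

theorem numDivisors_span_prime_pow_le {p : ℕ} (hp : p.Prime) (j : ℕ) :
    numDivisors (Ideal.span {((p ^ j : ℕ) : 𝓞 K)}) ≤ (j + 1) ^ Module.finrank ℚ K := by
  have h0 := span_natCast_ne_zero (K := K) hp.ne_zero
  set s := UniqueFactorizationMonoid.factors (Ideal.span {(p : 𝓞 K)}) with hs
  have hprod : s.prod = Ideal.span {(p : 𝓞 K)} :=
    associated_iff_eq.mp (UniqueFactorizationMonoid.factors_prod h0)
  have hprime : ∀ q ∈ s, Prime q := UniqueFactorizationMonoid.prime_of_factor
  have hcard : s.card ≤ Module.finrank ℚ K := by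
    have hN : (s.map Ideal.absNorm).prod = p ^ Module.finrank ℚ K := by
      rw [Multiset.prod_hom, hprod, absNorm_span_natCast]
    have hle : p ^ s.card ≤ (s.map Ideal.absNorm).prod := by
      rw [← Multiset.card_map Ideal.absNorm s]
      refine Multiset.pow_card_le_prod fun N hN' => ?_
      obtain ⟨q, hq, rfl⟩ := Multiset.mem_map.mp hN'
      have hdvd : Ideal.absNorm q ∣ p ^ Module.finrank ℚ K :=
        hN ▸ Multiset.dvd_prod (Multiset.mem_map_of_mem _ hq)
      obtain ⟨i, -, hi⟩ := (Nat.dvd_prime_pow hp).mp hdvd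
      have hi0 : i ≠ 0 := by
        rintro rfl
        exact (one_lt_absNorm (hprime q hq)).ne' hi
      rw [hi]
      exact Nat.le_self_pow hi0 p
    exact (Nat.pow_le_pow_iff_right hp.one_lt).mp (hle.trans hN.le)
  calc numDivisors (Ideal.span {((p ^ j : ℕ) : 𝓞 K)}) = numDivisors (s.prod ^ j) := by
        rw [hprod, Ideal.span_singleton_pow, Nat.cast_pow]
    _ ≤ (j + 1) ^ s.card := numDivisors_multiset_prod_pow_le s hprime j
    _ ≤ _ := Nat.pow_le_pow_right (by omega) hcard

theorem numDivisors_span_natCast_le (b : ℕ) (hb : b ≠ 0) :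
    numDivisors (Ideal.span {(b : 𝓞 K)}) ≤ b.divisors.card ^ Module.finrank ℚ K := by
  induction b using Nat.recOnPosPrimePosCoprime with
  | zero => exact absurd rfl hb
  | one => simp [← Ideal.one_eq_top, numDivisors_one]
  | prime_pow p j hp _ =>
    simpa [Nat.divisors_prime_pow hp] using numDivisors_span_prime_pow_le (K := K) hp j
  | coprime a b _ _ hab iha ihb =>
    have ha : a ≠ 0 := left_ne_zero_of_mul hb
    have hb' : b ≠ 0 := right_ne_zero_of_mul hb
    rw [Nat.cast_mul, ← Ideal.span_singleton_mul_span_singleton, hab.card_divisors_mul, mul_pow]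
    exact (numDivisors_mul_le (span_natCast_ne_zero ha) (span_natCast_ne_zero hb')).trans
      (Nat.mul_le_mul (iha ha) (ihb hb'))

theorem contractionGen_dvd_absNorm (I : Ideal (𝓞 K)) : contractionGen I ∣ Ideal.absNorm I := by
  rw [← Int.natCast_dvd_natCast, contractionGen_dvd_iff]
  simpa using Ideal.absNorm_mem I

theorem dvd_span_contractionGen (I : Ideal (𝓞 K)) :
    I ∣ Ideal.span {(contractionGen I : 𝓞 K)} := by
  rw [Ideal.dvd_span_singleton]
  simpa using (contractionGen_dvd_iff I (contractionGen I)).mp (dvd_refl _)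

theorem sum_numDivisors_pow_div_contractionGen_le (m N : ℕ) (s : Finset (Ideal (𝓞 K)))
    (hs : ∀ I ∈ s, I ≠ 0 ∧ Ideal.absNorm I ≤ N) :
    ∑ I ∈ s, ((numDivisors I : ℝ) ^ m / contractionGen I) ≤
      (1 + Real.log N) ^ 2 ^ (Module.finrank ℚ K * (m + 1)) := by
  classical
  have hmaps : ∀ I ∈ s, contractionGen I ∈ Finset.Icc 1 N := by
    intro I hI
    have hdvd := contractionGen_dvd_absNorm I
    have hpos := absNorm_pos (hs I hI).1
    exact Finset.mem_Icc.mpr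
      ⟨Nat.pos_of_dvd_of_pos hdvd hpos, (Nat.le_of_dvd hpos hdvd).trans (hs I hI).2⟩
  rw [← Finset.sum_fiberwise_of_maps_to hmaps]
  refine le_trans (Finset.sum_le_sum fun b hb => ?_) (sum_card_divisors_pow_div_le_log N _)
  have hb0 : b ≠ 0 := by have := (Finset.mem_Icc.mp hb).1; omega
  have hspan := span_natCast_ne_zero (K := K) hb0
  have hdvd : ∀ I ∈ s.filter (contractionGen · = b), I ∣ Ideal.span {(b : 𝓞 K)} := by
    intro I hI
    obtain ⟨-, rfl⟩ := Finset.mem_filter.mp hI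
    exact dvd_span_contractionGen I
  have hcard : (s.filter (contractionGen · = b)).card ≤ numDivisors (Ideal.span {(b : 𝓞 K)}) := by
    rw [numDivisors, Nat.card_coe_set_eq, ← Set.ncard_coe_finset]
    exact Set.ncard_le_ncard hdvd (finite_setOf_dvd hspan)
  calc ∑ I ∈ s with contractionGen I = b, ((numDivisors I : ℝ) ^ m / contractionGen I)
      ≤ ∑ I ∈ s with contractionGen I = b,
          ((numDivisors (Ideal.span {(b : 𝓞 K)}) : ℝ) ^ m / b) := by
        refine Finset.sum_le_sum fun I hI => ?_
        rw [(Finset.mem_filter.mp hI).2]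
        gcongr
        exact numDivisors_le_of_dvd hspan (hdvd I hI)
    _ ≤ (numDivisors (Ideal.span {(b : 𝓞 K)}) : ℝ) *
          ((numDivisors (Ideal.span {(b : 𝓞 K)}) : ℝ) ^ m / b) := by
        rw [Finset.sum_const, nsmul_eq_mul]
        gcongr
    _ = (numDivisors (Ideal.span {(b : 𝓞 K)}) : ℝ) ^ (m + 1) / b := by ring
    _ ≤ ((b.divisors.card : ℝ) ^ Module.finrank ℚ K) ^ (m + 1) / b := by
        gcongr
        exact_mod_cast numDivisors_span_natCast_le b hb0
    _ = _ := by rw [← pow_mul]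

/-- Elements of `[-Z, Z]` in a fixed residue class modulo `b`. -/
theorem card_le_of_forall_dvd_sub {b : ℕ} (hb : 0 < b) {Z : ℤ} (hZ : 0 ≤ Z) (S : Finset ℤ)
    (hS : S ⊆ Finset.Icc (-Z) Z) (hmod : ∀ s ∈ S, ∀ t ∈ S, (b : ℤ) ∣ s - t) :
    (S.card : ℝ) ≤ (2 * Z + 1) / b + 1 := by
  have hb' : (0 : ℤ) < b := by exact_mod_cast hb
  have hbR : (0 : ℝ) < b := by exact_mod_cast hb
  have hZR : (0 : ℝ) ≤ Z := by exact_mod_cast hZ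
  obtain rfl | ⟨v, hv⟩ := S.eq_empty_or_nonempty
  · simp only [Finset.card_empty, Nat.cast_zero]; positivity
  have hsub : S ⊆ {x ∈ Finset.Ioc (-Z - 1) Z | x ≡ v [ZMOD b]} := by
    intro s hs
    have h := Finset.mem_Icc.mp (hS hs)
    exact Finset.mem_filter.mpr ⟨Finset.mem_Ioc.mpr ⟨by omega, h.2⟩,
      (Int.modEq_iff_dvd.mpr (hmod v hv s hs))⟩
  have hcard : (S.card : ℤ) ≤
      max (⌊((Z : ℚ) - v) / (b : ℤ)⌋ - ⌊(((-Z - 1 : ℤ) : ℚ) - v) / (b : ℤ)⌋) 0 := by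
    rw [← Int.Ioc_filter_modEq_card _ _ hb']
    exact_mod_cast Finset.card_le_card hsub
  have hq : (S.card : ℚ) ≤ (2 * Z + 1) / b + 1 := by
    have hbQ : (0 : ℚ) < b := by exact_mod_cast hb
    have hZQ : (0 : ℚ) ≤ Z := by exact_mod_cast hZ
    rcases le_max_iff.mp hcard with h | h
    · have h1 := Int.floor_le (((Z : ℚ) - v) / (b : ℤ))
      have h2 := Int.lt_floor_add_one ((((-Z - 1 : ℤ) : ℚ) - v) / (b : ℤ))
      have h3 : (S.card : ℚ) ≤ (⌊((Z : ℚ) - v) / (b : ℤ)⌋ : ℚ) -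
          ⌊(((-Z - 1 : ℤ) : ℚ) - v) / (b : ℤ)⌋ := by exact_mod_cast h
      have h4 : ((Z : ℚ) - v) / (b : ℤ) - (((-Z - 1 : ℤ) : ℚ) - v) / (b : ℤ) =
          (2 * Z + 1) / b := by push_cast; ring
      linarith
    · have : (S.card : ℚ) ≤ 0 := by exact_mod_cast h
      exact this.trans (by positivity)
  exact_mod_cast hq

/-- The Type I estimate: counting vectors in a box whose linear form lies in a given ideal. -/
theorem card_filter_mem_le (d : ℕ) (α : 𝓞 K) (I : Ideal (𝓞 K)) (hI : I ≠ 0) {C₀ X : ℝ}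
    (hX : 1 ≤ X) (hIX : (contractionGen I : ℝ) ≤ C₀ * X) [DecidablePred (· ∈ I)] :
    (((Fintype.piFinset fun _ : Fin (d + 1) => Finset.Icc (-⌊X⌋) ⌊X⌋).filter
      fun x : Fin (d + 1) → ℤ => ∑ i, (x i : 𝓞 K) * α ^ (i : ℕ) ∈ I).card : ℝ) ≤
        3 ^ d * (3 + C₀) * X ^ (d + 1) / contractionGen I := by
  have hb : 0 < contractionGen I :=
    Nat.pos_of_dvd_of_pos (contractionGen_dvd_absNorm I) (absNorm_pos hI)
  have hbR : (0 : ℝ) < contractionGen I := by exact_mod_cast hb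
  have hZ : 0 ≤ ⌊X⌋ := Int.floor_nonneg.mpr (by linarith)
  have hZR : (0 : ℝ) ≤ (⌊X⌋ : ℝ) := by exact_mod_cast hZ
  have hZX : (⌊X⌋ : ℝ) ≤ X := Int.floor_le X
  set b := contractionGen I with hbdef
  have hcard := Finset.card_le_mul_card_image_of_maps_to
    (s := (Fintype.piFinset fun _ : Fin (d + 1) => Finset.Icc (-⌊X⌋) ⌊X⌋).filter
      fun x : Fin (d + 1) → ℤ => ∑ i, (x i : 𝓞 K) * α ^ (i : ℕ) ∈ I)
    (t := Fintype.piFinset fun _ : Fin d => Finset.Icc (-⌊X⌋) ⌊X⌋)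
    (f := fun x : Fin (d + 1) → ℤ => Fin.tail x)
    (fun x hx => by
      have := Fintype.mem_piFinset.mp (Finset.mem_filter.mp hx).1
      exact Fintype.mem_piFinset.mpr fun i => this i.succ)
    ⌊(2 * ⌊X⌋ + 1 : ℝ) / b + 1⌋₊ (fun y hy => by
      refine Nat.le_floor ?_
      rw [← Finset.card_image_of_injOn (f := fun x : Fin (d + 1) → ℤ => x 0)]
      · refine card_le_of_forall_dvd_sub hb hZ _ ?_ ?_
        · intro s hs
          obtain ⟨x, hx, rfl⟩ := Finset.mem_image.mp hs
          exact Fintype.mem_piFinset.mp (Finset.mem_filter.mp (Finset.mem_filter.mp hx).1).1 0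
        · intro s hs t ht
          obtain ⟨x, hx, rfl⟩ := Finset.mem_image.mp hs
          obtain ⟨x', hx', rfl⟩ := Finset.mem_image.mp ht
          obtain ⟨hx₁, rfl⟩ := Finset.mem_filter.mp hx
          obtain ⟨hx₂, htail⟩ := Finset.mem_filter.mp hx'
          have h := I.sub_mem (Finset.mem_filter.mp hx₁).2 (Finset.mem_filter.mp hx₂).2
          have htail' : ∀ i : Fin d, x' i.succ = x i.succ := fun i => congrFun htail i
          rw [hbdef, contractionGen_dvd_iff]
          simpa [Fin.sum_univ_succ, htail'] using h
      · intro x hx x' hx' h0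
        have h1 := (Finset.mem_filter.mp hx).2
        have h2 := (Finset.mem_filter.mp hx').2
        rw [← Fin.cons_self_tail x, ← Fin.cons_self_tail x', h1, h2]
        exact congrArg (fun z => (Fin.cons z y : Fin (d + 1) → ℤ)) h0)
  have hfl : (⌊(2 * ⌊X⌋ + 1 : ℝ) / b + 1⌋₊ : ℝ) ≤ (3 + C₀) * X / b := by
    refine (Nat.floor_le (by positivity)).trans ?_
    rw [div_add_one hbR.ne']
    gcongr
    linarith
  have hbox : ((Fintype.piFinset fun _ : Fin d => Finset.Icc (-⌊X⌋) ⌊X⌋).card : ℝ) ≤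
      (3 * X) ^ d := by
    rw [Fintype.card_piFinset_const, Nat.cast_pow, Int.card_Icc]
    gcongr
    have : (((⌊X⌋ + 1 - -⌊X⌋).toNat : ℤ) : ℝ) = 2 * ⌊X⌋ + 1 := by
      rw [Int.toNat_of_nonneg (by omega)]; push_cast; ring
    rw [Int.cast_natCast] at this
    rw [this]
    linarith
  calc _ ≤ (⌊(2 * ⌊X⌋ + 1 : ℝ) / b + 1⌋₊ : ℝ) *
        ((Fintype.piFinset fun _ : Fin d => Finset.Icc (-⌊X⌋) ⌊X⌋).card : ℝ) := by
        exact_mod_cast hcard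
    _ ≤ (3 + C₀) * X / b * (3 * X) ^ d := by
        gcongr
        exact (Nat.cast_nonneg _).trans hfl
    _ = _ := by rw [mul_pow]; ring

/-- Values of a linear form on a box of side `X` have norm `O(X ^ [K : ℚ])`. -/
theorem exists_absNorm_span_le (d : ℕ) (α : 𝓞 K) : ∃ C₀ : ℝ, 1 ≤ C₀ ∧ ∀ X : ℝ, 0 ≤ X →
    ∀ x : Fin (d + 1) → ℤ, (∀ i, |(x i : ℝ)| ≤ X) →
      (Ideal.absNorm (Ideal.span {∑ i, (x i : 𝓞 K) * α ^ (i : ℕ)}) : ℝ) ≤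
        (C₀ * X) ^ Module.finrank ℚ K := by
  have hsingle : ∀ σ : K →ₐ[ℚ] ℂ, ∑ i : Fin (d + 1), ‖σ α‖ ^ (i : ℕ) ≤
      ∑ σ : K →ₐ[ℚ] ℂ, ∑ i : Fin (d + 1), ‖σ α‖ ^ (i : ℕ) := fun σ =>
    Finset.single_le_sum (f := fun σ : K →ₐ[ℚ] ℂ => ∑ i : Fin (d + 1), ‖σ α‖ ^ (i : ℕ))
      (fun _ _ => by positivity) (Finset.mem_univ σ)
  refine ⟨∑ σ : K →ₐ[ℚ] ℂ, ∑ i : Fin (d + 1), ‖σ α‖ ^ (i : ℕ), ?_, ?_⟩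
  · have hne : Nonempty (K →ₐ[ℚ] ℂ) := ⟨IsAlgClosed.lift⟩
    refine le_trans ?_ (hsingle hne.some)
    have := Finset.single_le_sum (f := fun i : Fin (d + 1) => ‖hne.some (α : K)‖ ^ (i : ℕ))
      (fun _ _ => by positivity) (Finset.mem_univ 0)
    simpa using this
  · intro X hX x hx
    have hσ : ∀ σ : K →ₐ[ℚ] ℂ, ‖σ ((∑ i, (x i : 𝓞 K) * α ^ (i : ℕ) : 𝓞 K) : K)‖ ≤
        (∑ σ : K →ₐ[ℚ] ℂ, ∑ i : Fin (d + 1), ‖σ α‖ ^ (i : ℕ)) * X := by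
      intro σ
      refine le_trans ?_ (mul_le_mul_of_nonneg_right (hsingle σ) hX)
      simp only [map_sum, map_mul, map_pow, map_intCast]
      rw [Finset.sum_mul]
      refine (norm_sum_le _ _).trans (Finset.sum_le_sum fun i _ => ?_)
      rw [norm_mul, norm_pow, Complex.norm_intCast, mul_comm]
      exact mul_le_mul_of_nonneg_left (hx i) (by positivity)
    set β : 𝓞 K := ∑ i, (x i : 𝓞 K) * α ^ (i : ℕ) with hβ
    have hnorm : (Ideal.absNorm (Ideal.span {β}) : ℝ) = ∏ σ : K →ₐ[ℚ] ℂ, ‖σ (β : K)‖ := by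
      rw [← norm_prod, ← Algebra.norm_eq_prod_embeddings ℚ ℂ, ← Algebra.coe_norm_int,
        Ideal.absNorm_span_singleton]
      simp
    rw [hnorm, ← AlgHom.card ℚ K ℂ, ← Finset.card_univ, ← Finset.prod_const]
    exact Finset.prod_le_prod (fun _ _ => norm_nonneg _) fun σ _ => hσ σ

open scoped Classical in
/-- Moments of the divisor function over the values of a linear form on a box. -/
theorem exists_sum_numDivisors_rpow_le (d : ℕ) (α : 𝓞 K) (e : ℝ) :
    ∃ C c : ℝ, 0 < C ∧ 0 < c ∧ ∀ X : ℝ, 2 ≤ X →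
      ∑ x ∈ Fintype.piFinset fun _ : Fin (d + 1) => Finset.Icc (-⌊X⌋) ⌊X⌋,
        (if ∑ i, (x i : 𝓞 K) * α ^ (i : ℕ) ≠ 0 then
          (numDivisors (Ideal.span {∑ i, (x i : 𝓞 K) * α ^ (i : ℕ)}) : ℝ) ^ e else 0) ≤
      C * X ^ (d + 1) * Real.log X ^ c := by
  obtain ⟨C₀, hC₀, hnorm⟩ := exists_absNorm_span_le d α
  set n := Module.finrank ℚ K
  set E := ⌈e⌉₊
  set M := 2 ^ (n * (n * E + 1))
  have hlog2 : 0 < Real.log 2 := Real.log_pos (by norm_num)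
  have hlogC : 0 ≤ Real.log C₀ := Real.log_nonneg hC₀
  set C₁ := (1 + Real.log C₀) / Real.log 2 + 1
  refine ⟨(2 ^ n) ^ E * (3 ^ d * (3 + C₀)) * C₁ ^ M, M, by positivity, by positivity, ?_⟩
  intro X hX
  have hX0 : 0 < X := by linarith
  have hY : 1 ≤ C₀ * X := by nlinarith
  set N := ⌊C₀ * X⌋₊
  have hN1 : 1 ≤ N := Nat.le_floor (by simpa using hY)
  have hNY : (N : ℝ) ≤ C₀ * X := Nat.floor_le (by linarith)
  set G : Finset (Ideal (𝓞 K)) :=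
    ((Ideal.finite_setOfPred_absNorm_le (S := 𝓞 K) N).toFinset).filter (· ≠ 0) with hGdef
  have hG : ∀ I : Ideal (𝓞 K), I ∈ G ↔ I ≠ 0 ∧ Ideal.absNorm I ≤ N := by
    intro I
    simp [hGdef, and_comm]
  have hpoint : ∀ x ∈ Fintype.piFinset fun _ : Fin (d + 1) => Finset.Icc (-⌊X⌋) ⌊X⌋,
      (if ∑ i, (x i : 𝓞 K) * α ^ (i : ℕ) ≠ 0 then
          (numDivisors (Ideal.span {∑ i, (x i : 𝓞 K) * α ^ (i : ℕ)}) : ℝ) ^ e else 0) ≤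
      ∑ I ∈ G, if ∑ i, (x i : 𝓞 K) * α ^ (i : ℕ) ∈ I then
        (2 ^ n) ^ E * (numDivisors I : ℝ) ^ (n * E) else 0 := by
    intro x hx
    have hnn : ∀ I ∈ G, (0 : ℝ) ≤ if ∑ i, (x i : 𝓞 K) * α ^ (i : ℕ) ∈ I then
        (2 ^ n) ^ E * (numDivisors I : ℝ) ^ (n * E) else 0 := by
      intro I _
      split_ifs <;> positivity
    split_ifs with h
    swap
    · exact Finset.sum_nonneg hnn
    have hspan : Ideal.span {∑ i, (x i : 𝓞 K) * α ^ (i : ℕ)} ≠ 0 := by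
      simpa only [Ideal.zero_eq_bot, ne_eq, Ideal.span_singleton_eq_bot] using h
    have hxX : ∀ i, |(x i : ℝ)| ≤ X := by
      intro i
      obtain ⟨h1, h2⟩ := Finset.mem_Icc.mp (Fintype.mem_piFinset.mp hx i)
      have h1' : -(⌊X⌋ : ℝ) ≤ x i := by exact_mod_cast h1
      have h2' : (x i : ℝ) ≤ ⌊X⌋ := by exact_mod_cast h2
      have := Int.floor_le X
      exact abs_le.mpr ⟨by linarith, by linarith⟩
    obtain ⟨J, hJ, hJY, hτ⟩ := exists_dvd_numDivisors_le hY n _ hspan (hnorm X hX0.le x hxX)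
    have hJG : J ∈ G := (hG J).mpr ⟨ne_zero_of_dvd_ne_zero hspan hJ, Nat.le_floor hJY⟩
    refine le_trans ?_ (Finset.single_le_sum hnn hJG)
    rw [if_pos (Ideal.dvd_span_singleton.mp hJ)]
    have h1 : (1 : ℝ) ≤ numDivisors (Ideal.span {∑ i, (x i : 𝓞 K) * α ^ (i : ℕ)}) := by
      exact_mod_cast one_le_numDivisors hspan
    calc _ ≤ (numDivisors (Ideal.span {∑ i, (x i : 𝓞 K) * α ^ (i : ℕ)}) : ℝ) ^ (E : ℝ) :=
          Real.rpow_le_rpow_of_exponent_le h1 (Nat.le_ceil e)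
      _ = (numDivisors (Ideal.span {∑ i, (x i : 𝓞 K) * α ^ (i : ℕ)}) : ℝ) ^ E :=
          Real.rpow_natCast _ _
      _ ≤ (2 ^ n * (numDivisors J : ℝ) ^ n) ^ E := by
          gcongr
          exact_mod_cast hτ
      _ = _ := by rw [mul_pow, ← pow_mul (numDivisors J : ℝ)]
  have hlogX : Real.log 2 ≤ Real.log X := Real.log_le_log (by norm_num) hX
  have hlog : 1 + Real.log N ≤ C₁ * Real.log X := by
    have h1 : Real.log N ≤ Real.log C₀ + Real.log X := by
      rw [← Real.log_mul (by positivity) (by positivity)]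
      exact Real.log_le_log (by exact_mod_cast hN1) hNY
    have h2 : 1 + Real.log C₀ ≤ (1 + Real.log C₀) / Real.log 2 * Real.log X := by
      rw [div_mul_eq_mul_div, le_div_iff₀ hlog2]
      gcongr
    have h3 : C₁ * Real.log X = (1 + Real.log C₀) / Real.log 2 * Real.log X + Real.log X := by
      ring
    linarith
  have hlogN : 0 ≤ Real.log N := Real.log_natCast_nonneg N
  refine (Finset.sum_le_sum hpoint).trans ?_
  rw [Finset.sum_comm]
  calc _ ≤ ∑ I ∈ G, (2 ^ n) ^ E * (3 ^ d * (3 + C₀)) * X ^ (d + 1) *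
        ((numDivisors I : ℝ) ^ (n * E) / contractionGen I) := by
        refine Finset.sum_le_sum fun I hI => ?_
        obtain ⟨hI0, hIN⟩ := (hG I).mp hI
        have hgen : (contractionGen I : ℝ) ≤ C₀ * X := by
          refine le_trans ?_ hNY
          exact_mod_cast (Nat.le_of_dvd (absNorm_pos hI0) (contractionGen_dvd_absNorm I)).trans hIN
        rw [← Finset.sum_filter, Finset.sum_const, nsmul_eq_mul]
        refine (mul_le_mul_of_nonneg_right
          (card_filter_mem_le d α I hI0 (by linarith) hgen) (by positivity)).trans_eq ?_
        ring
    _ ≤ (2 ^ n) ^ E * (3 ^ d * (3 + C₀)) * X ^ (d + 1) * (1 + Real.log N) ^ M := by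
        rw [← Finset.mul_sum]
        gcongr
        exact sum_numDivisors_pow_div_contractionGen_le (n * E) N G fun I hI => (hG I).mp hI
    _ ≤ (2 ^ n) ^ E * (3 ^ d * (3 + C₀)) * X ^ (d + 1) * (C₁ * Real.log X) ^ M := by
        gcongr
    _ = _ := by rw [mul_pow, Real.rpow_natCast]; ring

end Ideals

open scoped Classical in
/-- **Moment bound for the divisor function on incomplete norm forms.**  Let `K = ℚ(θ^{1/n})`
with `x^n - θ` irreducible, `n > k ≥ 1`, and fix `e > 0`.  Then
`∑_{x ∈ ℤ^{n-k}, ‖x‖ ≤ X} τ((∑ xᵢ θ^{(i-1)/n}))^e ≪ X^{n-k} (log X)^{O_e(1)}`, where `τ(α)`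
is the number of ideal divisors of the principal ideal `(α)` (interpreted as `0` at `α = 0`),
the implied constants depending only on `n, k, θ, e`. -/
theorem stmt_9 (n k : ℕ) (hk : 1 ≤ k) (hkn : k < n) (θ : ℤ)
    (hirr : Irreducible ((Polynomial.X : Polynomial ℚ) ^ n - Polynomial.C (θ : ℚ)))
    (K : Type*) [Field K] [NumberField K] (hdeg : Module.finrank ℚ K = n)
    (α : NumberField.RingOfIntegers K) (hα : ((α : K)) ^ n = (θ : K))
    (hgen : Algebra.adjoin ℚ {((α : K))} = ⊤)
    (e : ℝ) (he : 0 < e) :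
    ∃ C c : ℝ, 0 < C ∧ 0 < c ∧ ∀ X : ℝ, 2 ≤ X →
      (∑' x : Fin (n - k) → ℤ,
        if Real.sqrt (∑ i, ((x i : ℝ)) ^ 2) ≤ X ∧
            (∑ i, (x i : NumberField.RingOfIntegers K) * α ^ (i : ℕ)) ≠ 0 then
          (Nat.card {𝔟 : Ideal (NumberField.RingOfIntegers K) |
              𝔟 ∣ Ideal.span {∑ i, (x i : NumberField.RingOfIntegers K) * α ^ (i : ℕ)}} : ℝ) ^ e
        else 0)
      ≤ C * X ^ (n - k) * (Real.log X) ^ c := by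
  obtain ⟨d, hd⟩ : ∃ d, n - k = d + 1 := ⟨n - k - 1, by omega⟩
  rw [hd]
  obtain ⟨C, c, hC, hc, h⟩ := exists_sum_numDivisors_rpow_le d α e
  refine ⟨C, c, hC, hc, fun X hX => le_trans ?_ (h X hX)⟩
  rw [tsum_eq_sum (s := Fintype.piFinset fun _ : Fin (d + 1) => Finset.Icc (-⌊X⌋) ⌊X⌋)]
  · refine Finset.sum_le_sum fun x _ => ?_
    by_cases hx : ∑ i, (x i : NumberField.RingOfIntegers K) * α ^ (i : ℕ) ≠ 0
    · rw [if_pos hx]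
      split_ifs
      · exact le_rfl
      · positivity
    · rw [if_neg hx, if_neg fun hx' => hx hx'.2]
  · intro x hx
    refine if_neg fun hx' => hx (Fintype.mem_piFinset.mpr fun i => ?_)
    have hi : |(x i : ℝ)| ≤ X := by
      rw [← Real.sqrt_sq_eq_abs]
      exact (Real.sqrt_le_sqrt (Finset.single_le_sum (f := fun i => (x i : ℝ) ^ 2)
        (fun _ _ => sq_nonneg _) (Finset.mem_univ i))).trans hx'.1
    obtain ⟨h1, h2⟩ := abs_le.mp hi
    refine Finset.mem_Icc.mpr ⟨?_, Int.le_floor.mpr h2⟩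
    have : -x i ≤ ⌊X⌋ := Int.le_floor.mpr (by push_cast; linarith)
    omega
end
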